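/- Let G : ℝ → ℝ be nondecreasing, let γ ∈ (0,1) and q ∈ ℝ with G(q) = γ, and suppose there are r > 0 and g₀ > 0 such that G(b) − G(a) ≥ g₀ (b − a) whenever q − r ≤ a ≤ b ≤ q + r. Let Ĝ : ℝ → ℝ be nondecreasing with sup_{z∈ℝ} |Ĝ(z) − G(z)| < g₀ δ for some 0 < δ ≤ r, and let q̂ = inf{z ∈ ℝ : Ĝ(z) ≥ γ}. Then |q̂ − q| ≤ δ. -/

import Mathlib

/-- part (ii) of the local inverse lemma. If a nondecreasing
`Ĝ` is uniformly within `g₀ δ` of `G` (strictly), then every lower empirical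
`γ`-quantile `q̂ = inf {z : γ ≤ Ĝ z}` satisfies `|q̂ - q| ≤ δ`. -/
theorem stmt_7
    (G : ℝ → ℝ) (hG : Monotone G)
    (γ : ℝ) (hγ : γ ∈ Set.Ioo (0 : ℝ) 1)
    (q : ℝ) (hq : G q = γ)
    (r g₀ : ℝ) (hr : 0 < r) (hg₀ : 0 < g₀)
    (hinc : ∀ a b : ℝ, q - r ≤ a → a ≤ b → b ≤ q + r → g₀ * (b - a) ≤ G b - G a)
    (Ghat : ℝ → ℝ) (hGhat : Monotone Ghat)
    (δ : ℝ) (hδ : 0 < δ) (hδr : δ ≤ r)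
    (hclose : ∀ z : ℝ, |Ghat z - G z| < g₀ * δ)
    (qhat : ℝ) (hqhat : qhat = sInf {z : ℝ | γ ≤ Ghat z}) :
    |qhat - q| ≤ δ := by
  have h1 := hinc q (q + δ) (by linarith) (by linarith) (by linarith)
  have h2 := hinc (q - δ) q (by linarith) (by linarith) (by linarith)
  have e1 : q + δ - q = δ := by ring
  have e2 : q - (q - δ) = δ := by ring
  rw [e1] at h1
  rw [e2] at h2
  have c1 := abs_lt.mp (hclose (q + δ))
  have c2 := abs_lt.mp (hclose (q - δ))
  have hmem : q + δ ∈ {z : ℝ | γ ≤ Ghat z} := by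
    show γ ≤ Ghat (q + δ)
    linarith [c1.1]
  have hlb : ∀ z ∈ {z : ℝ | γ ≤ Ghat z}, q - δ ≤ z := by
    intro z hz
    by_contra hlt
    have hm := hGhat (le_of_lt (not_le.mp hlt))
    have hz' : γ ≤ Ghat z := hz
    linarith [c2.2]
  have u : qhat ≤ q + δ := hqhat ▸ csInf_le ⟨q - δ, hlb⟩ hmem
  have l : q - δ ≤ qhat := hqhat ▸ le_csInf ⟨_, hmem⟩ hlb
  rw [abs_le]
  constructor <;> linarith
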